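/- Let $p>1$, let $t\geq 2$ be an integer, and let $(v,w)$ be a pair of weights on $\mathbb{R}$ with $\sigma = w^{1-p'}$ locally integrable. Suppose there is a constant $K>0$ such that for every interval $I=(a,b)$ with length $\ell_I = b-a$, one has $\left(\frac{t}{\ell_I}\int_a^{a+\ell_I/t} v\right)\left(\frac{t}{\ell_I}\int_{b-\ell_I/t}^{b}\sigma\right)^{p-1}\leq K$. Then for all $a<b<c$, $\left(\frac{1}{c-a}\int_a^b v\right)\left(\frac{1}{c-a}\int_b^c \sigma\right)^{p-1}\leq K$, i.e. $[v,w]_{A_p^+}\leq K$. -/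

import Mathlib

open MeasureTheory Real Set

/-- Peeling: the row estimate for the strip `[a, a + A/t] × [b, c]`. -/
lemma gap_peel (V S : ℝ → ℝ) (hV : Monotone V) (hS : Monotone S) (q K t : ℝ) (hq : 0 < q)
    (hK : 0 < K) (ht : 2 ≤ t)
    (h : ∀ x s, 0 < s → (V (x + s) - V x) * (S (x + t * s) - S (x + (t - 1) * s)) ^ q
      ≤ K * s ^ (q + 1))
    (a A L : ℝ) (hA : 0 < A) (n : ℕ) :
    ∀ u, A ≤ u → u ≤ L → ((t - 1) / t) ^ n * u ≤ A →
      (V (a + A / t) - V a) ^ (1 / q) * (S (a + u) - S (a + A))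
        ≤ (K * (L / t)) ^ (1 / q) * (u - (t - 1) / t * A) := by
  have ht0 : 0 < t := by linarith
  have hF : 0 ≤ V (a + A / t) - V a := by
    have : V a ≤ V (a + A / t) := hV (by have := div_pos hA ht0; linarith)
    linarith
  have hone : ∀ u, A ≤ u → u ≤ L →
      (V (a + A / t) - V a) ^ (1 / q) * (S (a + u) - S (a + (t - 1) / t * u))
        ≤ (K * (L / t)) ^ (1 / q) * (u / t) := by
    intro u hu huL
    have hu0 : 0 < u := by linarith
    have hs : 0 < u / t := div_pos hu0 ht0
    have h1 := h a (u / t) hs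
    have e1 : t * (u / t) = u := by field_simp
    have e2 : (t - 1) * (u / t) = (t - 1) / t * u := by ring
    rw [e1, e2] at h1
    have hle : (t - 1) / t * u ≤ u := by
      have : (t - 1) / t ≤ 1 := by rw [div_le_one ht0]; linarith
      nlinarith
    have hG : 0 ≤ S (a + u) - S (a + (t - 1) / t * u) := by
      have : S (a + (t - 1) / t * u) ≤ S (a + u) := hS (by linarith)
      linarith
    have hVle : V (a + A / t) - V a ≤ V (a + u / t) - V a := by
      have : V (a + A / t) ≤ V (a + u / t) := hV (by gcongr)
      linarith
    have h2 : (V (a + A / t) - V a) * (S (a + u) - S (a + (t - 1) / t * u)) ^ q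
        ≤ (K * (L / t)) * (u / t) ^ q := by
      calc _ ≤ (V (a + u / t) - V a) * (S (a + u) - S (a + (t - 1) / t * u)) ^ q := by
            gcongr
        _ ≤ K * (u / t) ^ (q + 1) := h1
        _ = (K * (u / t)) * (u / t) ^ q := by rw [rpow_add_one hs.ne']; ring
        _ ≤ _ := by gcongr
    have h3 := rpow_le_rpow (by positivity) h2 (by positivity : (0:ℝ) ≤ 1 / q)
    have hL : 0 < L := by linarith
    rw [mul_rpow hF (by positivity), mul_rpow (by positivity) (by positivity),
      ← rpow_mul hG, ← rpow_mul hs.le, mul_one_div_cancel hq.ne', rpow_one, rpow_one] at h3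
    exact h3
  induction n with
  | zero =>
    intro u hu huL hn
    have : u = A := by simp at hn; linarith
    subst this
    have : 0 ≤ u - (t - 1) / t * u := by
      have : (t - 1) / t ≤ 1 := by rw [div_le_one ht0]; linarith
      nlinarith
    simp only [sub_self, mul_zero]
    have hL : 0 < L := by linarith
    positivity
  | succ n ih =>
    intro u hu huL hn
    have h1 := hone u hu huL
    have hL : 0 < L := by linarith
    have hk : 0 ≤ (K * (L / t)) ^ (1 / q) := by positivity
    have hρ : u / t = u - (t - 1) / t * u := by field_simp; ring
    have hρ0 : 0 ≤ (t - 1) / t := div_nonneg (by linarith) ht0.le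
    have hρ1 : (t - 1) / t ≤ 1 := by rw [div_le_one ht0]; linarith
    have hFr : 0 ≤ (V (a + A / t) - V a) ^ (1 / q) := by positivity
    rcases le_total ((t - 1) / t * u) A with hc | hc
    · have hm : S (a + (t - 1) / t * u) ≤ S (a + A) := hS (by linarith)
      calc _ ≤ (V (a + A / t) - V a) ^ (1 / q) * (S (a + u) - S (a + (t - 1) / t * u)) := by
            gcongr
        _ ≤ _ := h1
        _ ≤ _ := by rw [hρ]; gcongr
    · have h2 := ih ((t - 1) / t * u) hc (by nlinarith) (by rw [pow_succ] at hn; linarith)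
      rw [hρ] at h1
      linarith

/-- The strip estimate. -/
lemma gap_strip (V S : ℝ → ℝ) (hV : Monotone V) (hS : Monotone S) (q K t : ℝ) (hq : 0 < q)
    (hK : 0 < K) (ht : 2 ≤ t)
    (h : ∀ x s, 0 < s → (V (x + s) - V x) * (S (x + t * s) - S (x + (t - 1) * s)) ^ q
      ≤ K * s ^ (q + 1))
    (a b c : ℝ) (hab : a < b) (hbc : b < c) (hA : c - a ≤ (q + 1) * (b - a)) :
    (V (a + (b - a) / t) - V a) * (S c - S b) ^ q
      ≤ K * ((c - a) ^ (q + 1) - (c - a - (b - a) / t) ^ (q + 1)) := by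
  have ht0 : 0 < t := by linarith
  obtain ⟨A, hAe⟩ : ∃ A, A = b - a := ⟨_, rfl⟩
  obtain ⟨L, hLe⟩ : ∃ L, L = c - a := ⟨_, rfl⟩
  rw [← hAe, ← hLe] at hA
  rw [← hAe, ← hLe]
  have hA0 : 0 < A := by linarith
  have hAL : A < L := by linarith
  have hL : 0 < L := by linarith
  have hρ0 : 0 ≤ (t - 1) / t := div_nonneg (by linarith) ht0.le
  have hρ1 : (t - 1) / t < 1 := by rw [div_lt_one ht0]; linarith
  obtain ⟨n, hn⟩ := exists_pow_lt_of_lt_one (div_pos hA0 hL) hρ1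
  have hp := gap_peel V S hV hS q K t hq hK ht h a A L hA0 n L hAL.le le_rfl
    ((lt_div_iff₀ hL).1 hn).le
  have e1 : a + L = c := by linarith
  have e2 : a + A = b := by linarith
  rw [e1, e2] at hp
  have hAt : 0 < A / t := div_pos hA0 ht0
  have hF : 0 ≤ V (a + A / t) - V a := by
    have : V a ≤ V (a + A / t) := hV (by linarith)
    linarith
  have hG : 0 ≤ S c - S b := by
    have : S b ≤ S c := hS hbc.le
    linarith
  have hρA : 0 ≤ L - (t - 1) / t * A := by nlinarith
  have h3 := rpow_le_rpow (by positivity) hp hq.le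
  rw [mul_rpow (by positivity) hG, mul_rpow (by positivity) hρA, ← rpow_mul hF,
    ← rpow_mul (by positivity), one_div_mul_cancel hq.ne', rpow_one, rpow_one] at h3
  refine h3.trans ?_
  have hρt : 1 / t ≤ (t - 1) / t := by gcongr; linarith
  have hle : L - (t - 1) / t * A ≤ L - A / t := by
    have : 1 / t * A ≤ (t - 1) / t * A := by gcongr
    have e : 1 / t * A = A / t := by ring
    linarith
  have hAt1 : A / t ≤ A := div_le_self hA0.le (by linarith)
  have hM : 0 < L - A / t := by linarith
  obtain ⟨M, hMe⟩ : ∃ M, M = L - A / t := ⟨_, rfl⟩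
  rw [← hMe] at hle hM
  rw [← hMe]
  have hb : M ^ (q + 1) + (q + 1) * (A / t) * M ^ q ≤ L ^ (q + 1) := by
    have hB := one_add_mul_self_le_rpow_one_add (s := A / t / M)
      (by have : 0 < A / t / M := by positivity
          linarith) (p := q + 1) (by linarith)
    have e : 1 + A / t / M = L / M := by
      rw [eq_div_iff hM.ne', add_mul, div_mul_cancel₀ _ hM.ne']; linarith
    rw [e, div_rpow hL.le hM.le, le_div_iff₀ (by positivity)] at hB
    refine le_trans (le_of_eq ?_) hB
    rw [rpow_add_one hM.ne']
    field_simp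
  have hq2 : (L - (t - 1) / t * A) ^ q ≤ M ^ q := rpow_le_rpow hρA hle hq.le
  have hLA : L / t ≤ (q + 1) * (A / t) := by
    rw [← mul_div_assoc]; gcongr
  calc K * (L / t) * (L - (t - 1) / t * A) ^ q ≤ K * ((q + 1) * (A / t)) * M ^ q := by gcongr
    _ = K * ((q + 1) * (A / t) * M ^ q) := by ring
    _ ≤ _ := by gcongr; linarith

/-- Concavity. -/
lemma gap_concave (P P1 Q Q1 θ : ℝ) (h0 : 0 ≤ Q1) (h1 : Q1 ≤ Q) (h2 : Q ≤ P)
    (h : P - P1 ≤ Q - Q1) (hθ0 : 0 ≤ θ) (hθ : θ ≤ 1) :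
    P ^ θ - P1 ^ θ ≤ Q ^ θ - Q1 ^ θ := by
  have hw : (P - Q + Q1) ^ θ ≤ P1 ^ θ := rpow_le_rpow (by linarith) (by linarith) hθ0
  rcases eq_or_lt_of_le (h1.trans h2) with he | hlt
  · have : Q = P := by linarith
    have : Q1 = P := by linarith
    subst_vars
    simp at hw ⊢
    linarith
  have hc := concaveOn_rpow hθ0 hθ
  have hd : 0 < P - Q1 := by linarith
  obtain ⟨l, hl⟩ : ∃ l, l = (Q - Q1) / (P - Q1) := ⟨_, rfl⟩
  have hl0 : 0 ≤ l := by rw [hl]; exact div_nonneg (by linarith) hd.le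
  have hl1 : l ≤ 1 := by rw [hl, div_le_one hd]; linarith
  have hlm : l * (P - Q1) = Q - Q1 := by rw [hl, div_mul_cancel₀ _ hd.ne']
  have hP : P ∈ Ici (0:ℝ) := by simp; linarith
  have hQ : Q1 ∈ Ici (0:ℝ) := h0
  have c1 := hc.2 hQ hP hl0 (by linarith : 0 ≤ 1 - l) (by ring)
  have c2 := hc.2 hQ hP (by linarith : 0 ≤ 1 - l) hl0 (by ring)
  simp only [smul_eq_mul] at c1 c2
  have e1 : l * Q1 + (1 - l) * P = P - Q + Q1 := by linarith
  have e2 : (1 - l) * Q1 + l * P = Q := by linarith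
  rw [e1] at c1
  rw [e2] at c2
  linarith

lemma gap_concave' (X X1 Z Z1 e m : ℝ) (hX : 0 ≤ X) (hX1 : 0 ≤ X1) (h0 : 0 ≤ Z1) (h1 : Z1 ≤ Z)
    (h2 : Z ≤ X) (he : 0 < e) (h : X ^ e - X1 ^ e ≤ Z ^ e - Z1 ^ e) (hm : 0 ≤ m) (hme : m ≤ e) :
    X ^ m - X1 ^ m ≤ Z ^ m - Z1 ^ m := by
  have hZ : 0 ≤ Z := h0.trans h1
  have := gap_concave (X ^ e) (X1 ^ e) (Z ^ e) (Z1 ^ e) (m / e) (by positivity)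
    (rpow_le_rpow h0 h1 he.le) (rpow_le_rpow hZ h2 he.le) h (by positivity)
    ((div_le_one he).2 hme)
  rwa [← rpow_mul hX, ← rpow_mul hX1, ← rpow_mul hZ, ← rpow_mul h0, mul_div_cancel₀ _ he.ne']
    at this

/-- The gap lemma for primitives. -/
lemma gap_main (V S : ℝ → ℝ) (hV : Monotone V) (hS : Monotone S) (hVc : Continuous V)
    (hSc : Continuous S) (q K t : ℝ) (hq : 0 < q) (hK : 0 < K) (ht : 2 ≤ t)
    (h : ∀ x s, 0 < s → (V (x + s) - V x) * (S (x + t * s) - S (x + (t - 1) * s)) ^ q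
      ≤ K * s ^ (q + 1))
    (a b c : ℝ) (hab : a < b) (hbc : b < c) :
    (V b - V a) * (S c - S b) ^ q ≤ K * (c - a) ^ (q + 1) := by
  by_contra hcon
  push Not at hcon
  have ht0 : 0 < t := by linarith
  have hr : 0 < 1 / q := by positivity
  have hKr : 0 < K ^ (1 / q) := by positivity
  -- the reflected hypothesis
  have h' : ∀ x s, 0 < s → ((fun y => - S (-y)) (x + s) - (fun y => - S (-y)) x) *
      ((fun y => - V (-y)) (x + t * s) - (fun y => - V (-y)) (x + (t - 1) * s)) ^ (1 / q)
      ≤ K ^ (1 / q) * s ^ (1 / q + 1) := by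
    intro x s hs
    have h1 := h (-x - t * s) s hs
    have e1 : -x - t * s + s = -(x + (t - 1) * s) := by ring
    have e2 : -x - t * s + t * s = -x := by ring
    have e3 : -x - t * s + (t - 1) * s = -(x + s) := by ring
    have e4 : -x - t * s = -(x + t * s) := by ring
    rw [e1, e2, e3, e4] at h1
    have hF : 0 ≤ V (-(x + (t - 1) * s)) - V (-(x + t * s)) := by
      have : V (-(x + t * s)) ≤ V (-(x + (t - 1) * s)) := hV (by linarith)
      linarith
    have hG : 0 ≤ S (-x) - S (-(x + s)) := by
      have : S (-(x + s)) ≤ S (-x) := hS (by linarith)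
      linarith
    have h3 := rpow_le_rpow (by positivity) h1 hr.le
    rw [mul_rpow hF (by positivity), mul_rpow hK.le (by positivity), ← rpow_mul hG,
      ← rpow_mul hs.le, mul_one_div_cancel hq.ne', rpow_one] at h3
    have e5 : (q + 1) * (1 / q) = 1 / q + 1 := by field_simp; ring
    rw [e5] at h3
    have e6 : -V (-(x + t * s)) - -V (-(x + (t - 1) * s))
      = V (-(x + (t - 1) * s)) - V (-(x + t * s)) := by ring
    have e7 : -S (-(x + s)) - -S (-x) = S (-x) - S (-(x + s)) := by ring
    simp only [e6, e7]
    linarith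
  obtain ⟨m, hm⟩ : ∃ m, m = min 1 (1 / q) := ⟨_, rfl⟩
  have hm0 : 0 < m := by rw [hm]; exact lt_min one_pos hr
  have hm1 : m ≤ 1 := hm ▸ min_le_left _ _
  have hmr : m ≤ 1 / q := hm ▸ min_le_right _ _
  let X : ℝ × ℝ → ℝ := fun z => (V b - V z.1) * (S z.2 - S b) ^ q
  let Z : ℝ × ℝ → ℝ := fun z => K * (z.2 - z.1) ^ (q + 1)
  let H : ℝ × ℝ → ℝ := fun z => X z ^ m - Z z ^ m
  have hXc : Continuous X := by
    refine Continuous.mul (by fun_prop) (Continuous.rpow_const (by fun_prop) ?_)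
    intro _; right; exact hq.le
  have hZc : Continuous Z := by
    refine Continuous.mul (by fun_prop) (Continuous.rpow_const (by fun_prop) ?_)
    intro _; right; linarith
  have hHc : Continuous H :=
    (hXc.rpow_const fun _ => Or.inr hm0.le).sub (hZc.rpow_const fun _ => Or.inr hm0.le)
  have hX0 : ∀ x y, x ≤ b → b ≤ y → 0 ≤ X (x, y) := by
    intro x y hx hy
    exact mul_nonneg (sub_nonneg.2 (hV hx)) (rpow_nonneg (sub_nonneg.2 (hS hy)) _)
  have hZ0 : ∀ x y, x ≤ y → 0 ≤ Z (x, y) := by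
    intro x y hx
    exact mul_nonneg hK.le (rpow_nonneg (sub_nonneg.2 hx) _)
  have hH0 : 0 < H (a, c) := by
    exact sub_pos.2 (rpow_lt_rpow (hZ0 a c (by linarith)) hcon hm0)
  have hcomp : IsCompact ((Icc a b ×ˢ Icc b c) ∩ {z : ℝ × ℝ | H (a, c) ≤ H z}) :=
    (isCompact_Icc.prod isCompact_Icc).inter_right (isClosed_le continuous_const hHc)
  obtain ⟨⟨x, y⟩, ⟨⟨⟨hx1, hx2⟩, ⟨hy1, hy2⟩⟩, hz⟩, hmin⟩ := hcomp.exists_isMinOn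
    ⟨(a, c), ⟨⟨⟨le_rfl, hab.le⟩, ⟨hbc.le, le_rfl⟩⟩, le_refl (H (a, c))⟩⟩
    (f := fun z : ℝ × ℝ => z.2 - z.1) (by fun_prop)
  simp only at hx1 hx2 hy1 hy2
  have hz : H (a, c) ≤ H (x, y) := hz
  rw [isMinOn_iff] at hmin
  have hXZ : Z (x, y) < X (x, y) := by
    have : 0 < X (x, y) ^ m - Z (x, y) ^ m := hH0.trans_le hz
    exact (rpow_lt_rpow_iff (hZ0 x y (by linarith)) (hX0 x y hx2 hy1) hm0).1 (by linarith)
  have hXpos : 0 < X (x, y) := (hZ0 x y (by linarith)).trans_lt hXZ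
  have hxb : x < b := by
    refine lt_of_le_of_ne hx2 fun he => ?_
    simp [X, he] at hXpos
  have hby : b < y := by
    refine lt_of_le_of_ne hy1 fun he => ?_
    simp [X, ← he, zero_rpow hq.ne'] at hXpos
  have hF : 0 ≤ V b - V x := sub_nonneg.2 (hV hx2)
  have hG : 0 ≤ S y - S b := sub_nonneg.2 (hS hy1)
  rcases le_total (y - x) ((q + 1) * (b - x)) with hc | hc
  · have hst := gap_strip V S hV hS q K t hq hK ht h x b y hxb hby hc
    have hd : 0 < (b - x) / t := div_pos (by linarith) ht0
    have hd1 : (b - x) / t ≤ b - x := div_le_self (by linarith) (by linarith)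
    have hle : Z (x + (b - x) / t, y) ≤ Z (x, y) := by
      simp only [Z]
      exact mul_le_mul_of_nonneg_left
        (rpow_le_rpow (by linarith) (by linarith) (by linarith)) hK.le
    have hcc := gap_concave' (X (x, y)) (X (x + (b - x) / t, y)) (Z (x, y))
      (Z (x + (b - x) / t, y)) 1 m hXpos.le (hX0 _ _ (by linarith) hy1) (hZ0 _ _ (by linarith))
      hle hXZ.le one_pos (by
        simp only [rpow_one, X, Z]
        have e : y - (x + (b - x) / t) = y - x - (b - x) / t := by ring
        rw [e]; linarith) hm0.le hm1
    have := hmin (x + (b - x) / t, y) ⟨⟨⟨by simp only; linarith, by simp only; linarith⟩,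
      ⟨hy1, hy2⟩⟩, by
        change H (a, c) ≤ X (x + (b - x) / t, y) ^ m - Z (x + (b - x) / t, y) ^ m
        change H (a, c) ≤ X (x, y) ^ m - Z (x, y) ^ m at hz
        linarith⟩
    simp only at this
    linarith
  · have hc' : -x - -y ≤ (1 / q + 1) * (-b - -y) := by
      have e : (1 / q + 1) * (-b - -y) = (q + 1) * (y - b) / q := by field_simp; ring
      rw [e, le_div_iff₀ hq]
      nlinarith
    have hst := gap_strip (fun y => - S (-y)) (fun y => - V (-y))
      (fun _ _ hh => neg_le_neg (hS (neg_le_neg hh))) (fun _ _ hh => neg_le_neg (hV (neg_le_neg hh)))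
      (1 / q) (K ^ (1 / q)) t hr hKr ht h' (-y) (-b) (-x) (by linarith) (by linarith) hc'
    have e1 : -(-y + (-b - -y) / t) = y - (y - b) / t := by ring
    have e2 : -x - -y = y - x := by ring
    have e3 : y - x - (-b - -y) / t = y - x - (y - b) / t := by ring
    simp only [e1, e2, e3, neg_neg] at hst
    have e4 : -V x - -V b = V b - V x := by ring
    rw [e4] at hst
    have hd : 0 < (y - b) / t := div_pos (by linarith) ht0
    have hd1 : (y - b) / t ≤ y - b := div_le_self (by linarith) (by linarith)
    have hle : Z (x, y - (y - b) / t) ≤ Z (x, y) := by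
      simp only [Z]
      exact mul_le_mul_of_nonneg_left
        (rpow_le_rpow (by linarith) (by linarith) (by linarith)) hK.le
    have hG' : 0 ≤ S (y - (y - b) / t) - S b := sub_nonneg.2 (hS (by linarith))
    have e5 : (q + 1) * (1 / q) = 1 / q + 1 := by field_simp; ring
    have hcc := gap_concave' (X (x, y)) (X (x, y - (y - b) / t)) (Z (x, y))
      (Z (x, y - (y - b) / t)) (1 / q) m hXpos.le (hX0 _ _ hx2 (by linarith))
      (hZ0 _ _ (by linarith)) hle hXZ.le hr (by
        simp only [X, Z]
        have n1 : 0 ≤ y - x := by linarith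
        have n2 : 0 ≤ y - (y - b) / t - x := by linarith
        rw [mul_rpow hF (by positivity), mul_rpow hF (by positivity),
          mul_rpow hK.le (by positivity), mul_rpow hK.le (by positivity), ← rpow_mul hG,
          ← rpow_mul hG', ← rpow_mul n1, ← rpow_mul n2, mul_one_div_cancel hq.ne', e5,
          rpow_one, rpow_one]
        have e : y - (y - b) / t - x = y - x - (y - b) / t := by ring
        rw [e]; linarith) hm0.le hmr
    have := hmin (x, y - (y - b) / t) ⟨⟨⟨hx1, hx2⟩,
      ⟨by simp only; linarith, by simp only; linarith⟩⟩, by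
        change H (a, c) ≤ X (x, y - (y - b) / t) ^ m - Z (x, y - (y - b) / t) ^ m
        change H (a, c) ≤ X (x, y) ^ m - Z (x, y) ^ m at hz
        linarith⟩
    simp only at this
    linarith

/-- **Gap lemma for the one-sided joint `A_p^+` condition.**
If the joint one-sided `A_p^+` condition holds "with a gap" of size `1/t`
(testing only the first and last subintervals of length `ℓ/t` of each interval),
with constant `K`, then the full joint `A_p^+` condition holds with constant `K`. -/
theorem gap_lemma_Ap_plus
    (p : ℝ) (hp : 1 < p) (t : ℕ) (ht : 2 ≤ t)
    (v w : ℝ → ℝ) (hv : ∀ x, 0 ≤ v x) (hw : ∀ x, 0 ≤ w x)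
    (hvloc : LocallyIntegrable v volume) (hwloc : LocallyIntegrable w volume)
    (σ : ℝ → ℝ) (hσ : ∀ x, σ x = (w x) ^ (-(1 / (p - 1))))
    (hσloc : LocallyIntegrable σ volume)
    (K : ℝ) (hK : 0 < K)
    (hgap : ∀ a b : ℝ, a < b →
      ((t : ℝ) / (b - a) * ∫ x in a..(a + (b - a) / t), v x) *
        ((t : ℝ) / (b - a) * ∫ x in (b - (b - a) / t)..b, σ x) ^ (p - 1) ≤ K) :
    ∀ a b c : ℝ, a < b → b < c →
      (1 / (c - a) * ∫ x in a..b, v x) *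
        (1 / (c - a) * ∫ x in b..c, σ x) ^ (p - 1) ≤ K := by
  intro a b c hab hbc
  have hσ0 : ∀ x, 0 ≤ σ x := fun x => by rw [hσ]; exact rpow_nonneg (hw x) _
  have vi : ∀ x y, IntervalIntegrable v volume x y := fun x y =>
    (hvloc.integrableOn_isCompact isCompact_uIcc).intervalIntegrable
  have si : ∀ x y, IntervalIntegrable σ volume x y := fun x y =>
    (hσloc.integrableOn_isCompact isCompact_uIcc).intervalIntegrable
  have vd : ∀ x y, ∫ z in x..y, v z = (∫ z in (0:ℝ)..y, v z) - ∫ z in (0:ℝ)..x, v z :=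
    fun x y => (intervalIntegral.integral_interval_sub_left (vi _ _) (vi _ _)).symm
  have sd : ∀ x y, ∫ z in x..y, σ z = (∫ z in (0:ℝ)..y, σ z) - ∫ z in (0:ℝ)..x, σ z :=
    fun x y => (intervalIntegral.integral_interval_sub_left (si _ _) (si _ _)).symm
  have vm : Monotone fun y => ∫ z in (0:ℝ)..y, v z := fun x y hxy => by
    have h1 := vd x y
    have h2 : 0 ≤ ∫ z in x..y, v z := intervalIntegral.integral_nonneg hxy fun z _ => hv z
    simp only; linarith
  have sm : Monotone fun y => ∫ z in (0:ℝ)..y, σ z := fun x y hxy => by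
    have h1 := sd x y
    have h2 : 0 ≤ ∫ z in x..y, σ z := intervalIntegral.integral_nonneg hxy fun z _ => hσ0 z
    simp only; linarith
  have ht2 : (2:ℝ) ≤ t := by exact_mod_cast ht
  have ht0 : (0:ℝ) < t := by linarith
  have hq : 0 < p - 1 := by linarith
  -- rescaling
  have hsc : ∀ k F G : ℝ, 0 < k → 0 ≤ G →
      ((1 / k * F) * (1 / k * G) ^ (p - 1) ≤ K ↔ F * G ^ (p - 1) ≤ K * k ^ (p - 1 + 1)) := by
    intro k F G hk hG
    rw [mul_rpow (by positivity) hG, div_rpow one_pos.le hk.le, one_rpow, rpow_add_one hk.ne']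
    have hkp : 0 < k ^ (p - 1) := by positivity
    have e : 1 / k * F * (1 / k ^ (p - 1) * G ^ (p - 1))
      = F * G ^ (p - 1) / (k ^ (p - 1) * k) := by field_simp
    rw [e, div_le_iff₀ (by positivity)]
  have hmain := gap_main _ _ vm sm
    (intervalIntegral.continuous_primitive vi 0) (intervalIntegral.continuous_primitive si 0)
    (p - 1) K t hq hK ht2 (by
      intro x s hs
      have h1 := hgap x (x + t * s) (by have := mul_pos ht0 hs; linarith)
      have e1 : x + t * s - x = t * s := by ring
      have e2 : (t:ℝ) * s / t = s := by field_simp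
      have e3 : (t:ℝ) / (t * s) = 1 / s := by field_simp
      have e4 : x + t * s - s = x + (t - 1) * s := by ring
      rw [e1, e2, e3, e4] at h1
      rw [hsc s _ _ hs (intervalIntegral.integral_nonneg (by linarith) fun z _ => hσ0 z),
        vd, sd] at h1
      exact h1) a b c hab hbc
  rw [hsc (c - a) _ _ (by linarith) (intervalIntegral.integral_nonneg hbc.le fun z _ => hσ0 z),
    vd, sd]
  exact hmain
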